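/- Let $s>0$, $1<p<\infty$, $d\ge1$, $k\ge1$, and $\phi\in\mathcal{S}(\mathbb{R}^d)$. Then $\|J^s(\phi(x)e^{ikx_1})-\langle k\rangle^s\phi(x)e^{ikx_1}\|_{L^p}\le C(\phi,d,s,p)\,k^{s-1}$, where $J^s=(1-\Delta)^{s/2}$ and $\langle k\rangle=(1+k^2)^{1/2}$. -/

import Mathlib

open MeasureTheory
open scoped ENNReal RealInnerProductSpace

noncomputable abbrev Ed (d : ℕ) := EuclideanSpace ℝ (Fin d)

/-- The Fourier transform in the convention `f̂(ξ) = ∫ f(x) e^{-i x·ξ} dx`. -/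
noncomputable def pFT {d : ℕ} (f : Ed d → ℂ) (ξ : Ed d) : ℂ :=
  ∫ x : Ed d, Complex.exp (-(Complex.I) * ((⟪x, ξ⟫ : ℝ) : ℂ)) * f x


open Finset

section Norm

variable {E : Type*} [NormedAddCommGroup E]

/-- The symbol `(1 + ‖x‖²)^r` of the Bessel potential of order `2r`. -/
noncomputable def besselSymbol (r : ℝ) (x : E) : ℝ := (1 + ‖x‖ ^ 2) ^ r

theorem besselSymbol_pos (r : ℝ) (x : E) : 0 < besselSymbol r x :=
  Real.rpow_pos_of_pos (by positivity) r

theorem besselSymbol_add (r t : ℝ) (x : E) :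
    besselSymbol (r + t) x = besselSymbol r x * besselSymbol t x :=
  Real.rpow_add (by positivity) r t

theorem besselSymbol_mono {r t : ℝ} (h : r ≤ t) (x : E) : besselSymbol r x ≤ besselSymbol t x :=
  Real.rpow_le_rpow_of_exponent_le (by simp) h

theorem norm_le_besselSymbol_half (x : E) : ‖x‖ ≤ besselSymbol (1 / 2) x := by
  rw [besselSymbol, ← Real.sqrt_eq_rpow]
  exact Real.le_sqrt_of_sq_le (by linarith)

theorem one_le_besselSymbol_half (x : E) : 1 ≤ besselSymbol (1 / 2) x :=
  Real.one_le_rpow (by simp) (by norm_num)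

/-- Peetre's inequality. -/
theorem besselSymbol_add_le (t : ℝ) (x y : E) :
    besselSymbol t (x + y) ≤ 2 ^ |t| * besselSymbol t x * besselSymbol |t| y := by
  have key (a b : E) : 1 + ‖a + b‖ ^ 2 ≤ 2 * (1 + ‖a‖ ^ 2) * (1 + ‖b‖ ^ 2) := by
    have h : ‖a + b‖ ^ 2 ≤ (‖a‖ + ‖b‖) ^ 2 := by gcongr; exact norm_add_le a b
    nlinarith [sq_nonneg (‖a‖ - ‖b‖), mul_nonneg (sq_nonneg ‖a‖) (sq_nonneg ‖b‖)]
  unfold besselSymbol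
  rcases le_total 0 t with ht | ht
  · rw [abs_of_nonneg ht, ← Real.mul_rpow (by positivity) (by positivity),
      ← Real.mul_rpow (by positivity) (by positivity)]
    exact Real.rpow_le_rpow (by positivity) (key x y) ht
  · have h := Real.rpow_le_rpow (by positivity) (key (x + y) (-y)) (neg_nonneg.2 ht)
    rw [Real.mul_rpow (by positivity) (by positivity), Real.mul_rpow (by positivity)
      (by positivity), add_neg_cancel_right, norm_neg, Real.rpow_neg (by positivity) t,
      Real.rpow_neg (x := 1 + ‖x + y‖ ^ 2) (by positivity) t] at h
    rw [abs_of_nonpos ht]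
    have hx : 0 < (1 + ‖x‖ ^ 2) ^ t := by positivity
    have hxy : 0 < (1 + ‖x + y‖ ^ 2) ^ t := by positivity
    field_simp at h
    linarith

theorem exists_besselSymbol_le_one_add_norm_pow (t : ℝ) :
    ∃ N : ℕ, ∀ x : E, besselSymbol t x ≤ (1 + ‖x‖) ^ N := by
  refine ⟨2 * ⌈t⌉₊, fun x ↦ (besselSymbol_mono (Nat.le_ceil t) x).trans ?_⟩
  rw [besselSymbol, Real.rpow_natCast, pow_mul]
  gcongr
  nlinarith [norm_nonneg x]

end Norm

section Bessel

variable {E F : Type*} [NormedAddCommGroup E] [InnerProductSpace ℝ E]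
  [NormedAddCommGroup F] [NormedSpace ℝ F]

theorem contDiff_besselSymbol (r : ℝ) {n : ℕ∞} : ContDiff ℝ n (besselSymbol r : E → ℝ) :=
  (Function.hasTemperateGrowth_one_add_norm_sq_rpow E r).1.of_le (mod_cast le_top)

theorem exists_fderiv_besselSymbol_eq (r : ℝ) : ∃ L : E →L[ℝ] E →L[ℝ] ℝ,
    fderiv ℝ (besselSymbol r : E → ℝ) = fun x ↦ besselSymbol (r - 1) x • L x := by
  refine ⟨(2 * r) • innerSL ℝ (E := E), funext fun x ↦ ?_⟩
  have h := ((hasStrictFDerivAt_norm_sq x).hasFDerivAt.const_add 1).rpow_const (p := r)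
    (Or.inl (by positivity))
  refine h.fderiv.trans ?_
  ext y
  change _ = besselSymbol (r - 1) x * (2 * r * inner ℝ x y)
  change r * (1 + ‖x‖ ^ 2) ^ (r - 1) * (2 • inner ℝ x y) = _
  rw [besselSymbol, two_nsmul]
  ring

theorem norm_iteratedFDeriv_continuousLinearMap_le (L : E →L[ℝ] F) (n : ℕ) (x : E) :
    ‖iteratedFDeriv ℝ n L x‖ ≤ ‖L‖ * besselSymbol (1 / 2) x := by
  rcases n with _ | n
  · rw [norm_iteratedFDeriv_zero]
    exact (L.le_opNorm x).trans (by gcongr; exact norm_le_besselSymbol_half x)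
  · have hL : fderiv ℝ L = fun _ ↦ L := by ext1 y; exact L.fderiv
    refine le_trans ?_ (le_mul_of_one_le_right (norm_nonneg L) (one_le_besselSymbol_half x))
    rw [← norm_iteratedFDeriv_fderiv, hL]
    rcases n with _ | n
    · simp
    · simp [iteratedFDeriv_const_of_ne]

theorem exists_norm_iteratedFDeriv_succ_besselSymbol_le_of_forall {r : ℝ} {n : ℕ}
    (h : ∀ i ≤ n, ∃ C, ∀ x : E,
      ‖iteratedFDeriv ℝ i (besselSymbol (r - 1)) x‖ ≤ C * besselSymbol (r - 1) x) :
    ∃ C, ∀ x : E,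
      ‖iteratedFDeriv ℝ (n + 1) (besselSymbol r) x‖ ≤ C * besselSymbol (r - 1 / 2) x := by
  choose! C hC using h
  obtain ⟨L, hL⟩ := exists_fderiv_besselSymbol_eq (E := E) r
  refine ⟨∑ i ∈ range (n + 1), n.choose i * C i * ‖L‖, fun x ↦ ?_⟩
  rw [← norm_iteratedFDeriv_fderiv, hL]
  refine (norm_iteratedFDeriv_smul_le (contDiff_besselSymbol (n := n) _) L.contDiff x le_rfl).trans ?_
  rw [sum_mul]
  refine sum_le_sum fun i hi ↦ ?_
  have hi' : i ≤ n := by simpa [Nat.lt_succ_iff] using hi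
  have hr : besselSymbol (r - 1 / 2) x = besselSymbol (r - 1) x * besselSymbol (1 / 2) x := by
    rw [← besselSymbol_add]; ring_nf
  calc _ ≤ (n.choose i : ℝ) * (C i * besselSymbol (r - 1) x) *
        (‖L‖ * besselSymbol (1 / 2) x) := by
        have := (norm_nonneg _).trans (hC i hi' x)
        gcongr
        · exact hC i hi' x
        · exact norm_iteratedFDeriv_continuousLinearMap_le _ _ x
    _ = _ := by rw [hr]; ring

theorem exists_norm_iteratedFDeriv_besselSymbol_le (n : ℕ) (r : ℝ) :
    ∃ C, ∀ x : E, ‖iteratedFDeriv ℝ n (besselSymbol r) x‖ ≤ C * besselSymbol r x := by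
  induction n using Nat.strong_induction_on generalizing r with
  | _ n ih =>
    rcases n with _ | n
    · exact ⟨1, fun x ↦ by simp [abs_of_pos (besselSymbol_pos r x)]⟩
    · obtain ⟨C, hC⟩ := exists_norm_iteratedFDeriv_succ_besselSymbol_le_of_forall (E := E)
        (r := r) (n := n) fun i hi ↦ ih i (by omega) _
      refine ⟨|C|, fun x ↦ (hC x).trans ?_⟩
      gcongr
      · exact (besselSymbol_pos _ x).le
      · exact le_abs_self C
      · exact besselSymbol_mono (by norm_num) x

theorem exists_norm_iteratedFDeriv_succ_besselSymbol_le (n : ℕ) (r : ℝ) :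
    ∃ C, 0 ≤ C ∧ ∀ x : E,
      ‖iteratedFDeriv ℝ (n + 1) (besselSymbol r) x‖ ≤ C * besselSymbol (r - 1 / 2) x := by
  obtain ⟨C, hC⟩ := exists_norm_iteratedFDeriv_succ_besselSymbol_le_of_forall (E := E)
    fun i _ ↦ exists_norm_iteratedFDeriv_besselSymbol_le i (r - 1)
  exact ⟨|C|, abs_nonneg C, fun x ↦ (hC x).trans <|
    mul_le_mul_of_nonneg_right (le_abs_self C) (besselSymbol_pos _ x).le⟩

/-- Derivatives of `⟨· + v⟩^{2r} - ⟨v⟩^{2r}` gain half an order in `v`, up to polynomial factors. -/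
theorem exists_norm_iteratedFDeriv_besselSymbol_sub_le (n : ℕ) (r : ℝ) :
    ∃ (C : ℝ) (N : ℕ), 0 ≤ C ∧ ∀ v x : E,
      ‖iteratedFDeriv ℝ n (fun y ↦ besselSymbol r (y + v) - besselSymbol r v) x‖ ≤
        C * besselSymbol (r - 1 / 2) v * (1 + ‖x‖) ^ N := by
  obtain ⟨N, hN⟩ := exists_besselSymbol_le_one_add_norm_pow (E := E) |r - 1 / 2|
  have hpeetre (v x : E) : besselSymbol (r - 1 / 2) (v + x) ≤
      2 ^ |r - 1 / 2| * besselSymbol (r - 1 / 2) v * (1 + ‖x‖) ^ N :=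
    (besselSymbol_add_le _ v x).trans <| by
      have := besselSymbol_pos (r - 1 / 2) v
      gcongr
      exact hN x
  rcases n with _ | n
  · obtain ⟨C, hC0, hC⟩ := exists_norm_iteratedFDeriv_succ_besselSymbol_le (E := E) 0 r
    refine ⟨C * 2 ^ |r - 1 / 2|, N + 1, by positivity, fun v x ↦ ?_⟩
    have hv := besselSymbol_pos (r - 1 / 2) v
    have hmv := (convex_closedBall v ‖x‖).norm_image_sub_le_of_norm_fderiv_le (𝕜 := ℝ)
      (f := besselSymbol r) (x := v) (y := x + v)
      (C := C * (2 ^ |r - 1 / 2| * besselSymbol (r - 1 / 2) v * (1 + ‖x‖) ^ N))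
      (fun y _ ↦ (contDiff_besselSymbol r (n := 1)).differentiable (by simp) y)
      (fun y hy ↦ by
        have h := hC y
        rw [← norm_iteratedFDeriv_fderiv, norm_iteratedFDeriv_zero] at h
        have hy' : ‖y - v‖ ≤ ‖x‖ := mem_closedBall_iff_norm.1 hy
        refine h.trans (mul_le_mul_of_nonneg_left ?_ hC0)
        have := hpeetre v (y - v)
        rw [add_sub_cancel] at this
        exact this.trans (by gcongr))
      (by simp) (by simp)
    rw [add_sub_cancel_right] at hmv
    rw [norm_iteratedFDeriv_zero]
    refine hmv.trans ?_
    calc _ ≤ C * (2 ^ |r - 1 / 2| * besselSymbol (r - 1 / 2) v * (1 + ‖x‖) ^ N) * (1 + ‖x‖) := by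
          gcongr; linarith
      _ = _ := by ring
  · obtain ⟨C, hC0, hC⟩ := exists_norm_iteratedFDeriv_succ_besselSymbol_le (E := E) n r
    refine ⟨C * 2 ^ |r - 1 / 2|, N, by positivity, fun v x ↦ ?_⟩
    have hd : ContDiff ℝ (n + 1 : ℕ) fun y : E ↦ besselSymbol r (y + v) :=
      (contDiff_besselSymbol r (n := (n + 1 : ℕ))).comp (contDiff_id.add contDiff_const)
    rw [fun_iteratedFDeriv_sub_apply hd.contDiffAt contDiff_const.contDiffAt,
      iteratedFDeriv_comp_add_right, iteratedFDeriv_const_of_ne (by omega)]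
    simp only [Pi.zero_apply, sub_zero]
    refine (hC _).trans ?_
    rw [add_comm x v, mul_assoc, mul_assoc]
    gcongr
    simpa [mul_assoc] using hpeetre v x

/-- Schwartz seminorms of a product with a smooth polynomially bounded multiplier are controlled
uniformly in the multiplier. -/
theorem SchwartzMap.exists_seminorm_smul_le (φ : SchwartzMap E ℂ) (a n : ℕ) (C : ℕ → ℝ)
    (N : ℕ → ℕ) (hC0 : ∀ i, 0 ≤ C i) :
    ∃ K, 0 ≤ K ∧ ∀ (A : ℝ) (m : E → ℝ) (g : SchwartzMap E ℂ), 0 ≤ A → ContDiff ℝ n m →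
      (∀ i ≤ n, ∀ x, ‖iteratedFDeriv ℝ i m x‖ ≤ C i * A * (1 + ‖x‖) ^ N i) →
      (∀ x, g x = m x • φ x) → SchwartzMap.seminorm ℝ a n g ≤ K * A := by
  let S (i : ℕ) : ℝ := 2 ^ (a + N i) * (Iic (a + N i, n - i)).sup
    (fun m ↦ SchwartzMap.seminorm ℝ m.1 m.2) φ
  have hS0 (i : ℕ) : 0 ≤ S i := mul_nonneg (by positivity) (apply_nonneg _ _)
  have hS (i : ℕ) (x : E) : (1 + ‖x‖) ^ (a + N i) * ‖iteratedFDeriv ℝ (n - i) φ x‖ ≤ S i :=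
    SchwartzMap.one_add_le_sup_seminorm_apply (𝕜 := ℝ) (m := (a + N i, n - i)) le_rfl le_rfl φ x
  refine ⟨∑ i ∈ range (n + 1), n.choose i * C i * S i,
    sum_nonneg fun i _ ↦ mul_nonneg (mul_nonneg (by positivity) (hC0 i)) (hS0 i),
    fun A m g hA hm hbound hg ↦ ?_⟩
  have hK : 0 ≤ (∑ i ∈ range (n + 1), n.choose i * C i * S i) * A :=
    mul_nonneg (sum_nonneg fun i _ ↦ mul_nonneg (mul_nonneg (by positivity) (hC0 i)) (hS0 i)) hA
  refine SchwartzMap.seminorm_le_bound ℝ a n g hK fun x ↦ ?_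
  rw [show (g : E → ℂ) = fun x ↦ m x • φ x from funext hg]
  grw [norm_iteratedFDeriv_smul_le hm (φ.smooth n) x le_rfl]
  rw [mul_sum, sum_mul]
  refine sum_le_sum fun i hi ↦ ?_
  have hi' : i ≤ n := by simpa [Nat.lt_succ_iff] using hi
  have := hC0 i
  calc _ ≤ (1 + ‖x‖) ^ a * (n.choose i * (C i * A * (1 + ‖x‖) ^ N i) *
        ‖iteratedFDeriv ℝ (n - i) φ x‖) := by
        gcongr
        · linarith
        · exact hbound i hi' x
    _ = n.choose i * C i * ((1 + ‖x‖) ^ (a + N i) * ‖iteratedFDeriv ℝ (n - i) φ x‖) * A := by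
        ring
    _ ≤ _ := by gcongr; exact hS i x

end Bessel

section Fourier

open FourierTransform

variable {d : ℕ}

/-- The wave `x ↦ e^{i x·v}`. -/
noncomputable def planeWave (v x : Ed d) : ℂ := Complex.exp (Complex.I * (⟪x, v⟫ : ℝ))

theorem hasTemperateGrowth_exp_I_mul :
    (fun t : ℝ ↦ Complex.exp (Complex.I * t)).HasTemperateGrowth := by
  have hderiv (n : ℕ) : iteratedDeriv n (fun t : ℝ ↦ Complex.exp (Complex.I * t)) =
      fun t : ℝ ↦ Complex.I ^ n * Complex.exp (Complex.I * t) := by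
    induction n with
    | zero => simp
    | succ n ih =>
      rw [iteratedDeriv_succ, ih]
      ext t
      have h := (((hasDerivAt_id t).ofReal_comp.const_mul Complex.I).cexp).const_mul
        (Complex.I ^ n)
      refine h.deriv.trans ?_
      simp
      ring
  refine ⟨(contDiff_const.mul Complex.ofRealCLM.contDiff).cexp, fun n ↦ ⟨0, 1, fun t ↦ ?_⟩⟩
  rw [norm_iteratedFDeriv_eq_norm_iteratedDeriv, hderiv]
  simp [mul_comm Complex.I, Complex.norm_exp_ofReal_mul_I]

theorem hasTemperateGrowth_planeWave (v : Ed d) : (planeWave v).HasTemperateGrowth :=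
  hasTemperateGrowth_exp_I_mul.comp (Function.hasTemperateGrowth_inner_left v)

theorem norm_planeWave (v x : Ed d) : ‖planeWave v x‖ = 1 := by
  rw [planeWave, mul_comm, Complex.norm_exp_ofReal_mul_I]

theorem planeWave_neg_mul_self (v x : Ed d) : planeWave (-v) x * planeWave v x = 1 := by
  simp [planeWave, ← Complex.exp_add]

theorem pFT_eq_fourier (f : Ed d → ℂ) (ξ : Ed d) :
    pFT f ξ = 𝓕 f ((2 * Real.pi)⁻¹ • ξ) := by
  rw [pFT, Real.fourier_eq']
  congr 1 with x
  rw [inner_smul_right, smul_eq_mul]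
  congr 2
  push_cast
  field_simp

theorem pFT_planeWave_neg_mul (v : Ed d) (f : Ed d → ℂ) (ξ : Ed d) :
    pFT (fun x ↦ planeWave (-v) x * f x) ξ = pFT f (ξ + v) := by
  unfold pFT planeWave
  congr 1 with x
  rw [← mul_assoc, ← Complex.exp_add, inner_add_right, inner_neg_right]
  congr 2
  push_cast
  ring

theorem pFT_sub_const_mul (f g : SchwartzMap (Ed d) ℂ) (c : ℂ) (ξ : Ed d) :
    pFT (f - c • g) ξ = pFT f ξ - c * pFT g ξ := by
  have h := congrArg (fun F : SchwartzMap (Ed d) ℂ ↦ F ((2 * Real.pi)⁻¹ • ξ))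
    (map_sub (fourierCLM ℂ (SchwartzMap (Ed d) ℂ)) f (c • g))
  simp only [map_smul, fourierCLM_apply] at h
  simpa [pFT_eq_fourier, SchwartzMap.fourier_coe] using h

/-- `pFT` acting on Schwartz functions. -/
noncomputable def schwartzPFT (f : SchwartzMap (Ed d) ℂ) : SchwartzMap (Ed d) ℂ :=
  SchwartzMap.compCLMOfContinuousLinearEquiv ℝ
    (ContinuousLinearEquiv.smulLeft (Units.mk0 (2 * Real.pi)⁻¹ (by positivity))) (𝓕 f)

theorem schwartzPFT_apply (f : SchwartzMap (Ed d) ℂ) (ξ : Ed d) :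
    schwartzPFT f ξ = pFT f ξ := by
  rw [pFT_eq_fourier]
  rfl

theorem exists_leftInverse_schwartzPFT :
    ∃ Q : SchwartzMap (Ed d) ℂ →L[ℝ] SchwartzMap (Ed d) ℂ, ∀ f, Q (schwartzPFT f) = f := by
  refine ⟨(fourierInvCLM ℝ (SchwartzMap (Ed d) ℂ)).comp
    (SchwartzMap.compCLMOfContinuousLinearEquiv ℝ
      (ContinuousLinearEquiv.smulLeft (Units.mk0 (2 * Real.pi) (by positivity)))), fun f ↦ ?_⟩
  refine Eq.trans (congrArg 𝓕⁻ (?_ : _ = 𝓕 f)) (fourierInv_fourier_eq f)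
  ext ξ
  change 𝓕 f ((2 * Real.pi)⁻¹ • (2 * Real.pi) • ξ) = 𝓕 f ξ
  rw [inv_smul_smul₀ (by positivity)]

theorem exists_norm_toLp_le_seminorm_schwartzPFT (p : ℝ≥0∞) [Fact (1 ≤ p)] :
    ∃ (t : Finset (ℕ × ℕ)) (C : NNReal), ∀ f : SchwartzMap (Ed d) ℂ,
      ‖f.toLp p‖ ≤ C * t.sup (schwartzSeminormFamily ℝ (Ed d) ℂ) (schwartzPFT f) := by
  obtain ⟨Q, hQ⟩ := exists_leftInverse_schwartzPFT (d := d)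
  let T := (SchwartzMap.toLpCLM ℝ ℂ p (volume : Measure (Ed d))).comp Q
  obtain ⟨t, C, -, h⟩ := Seminorm.bound_of_continuous
    (schwartz_withSeminorms ℝ (Ed d) ℂ) ((normSeminorm ℝ _).comp T.toLinearMap)
    (continuous_norm.comp T.continuous)
  refine ⟨t, C, fun f ↦ ?_⟩
  have hT : T (schwartzPFT f) = f.toLp p := congrArg (SchwartzMap.toLp · p) (hQ f)
  rw [← hT]
  exact h (schwartzPFT f)

/-- The estimate for a general frequency `v`, with the Bessel potential of order `2r`. -/
theorem exists_eLpNorm_bessel_planeWave_sub_le (r : ℝ) (p : ℝ≥0∞) [Fact (1 ≤ p)]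
    (φ : SchwartzMap (Ed d) ℂ) :
    ∃ C : ℝ, 0 ≤ C ∧ ∀ (v : Ed d) (G : SchwartzMap (Ed d) ℂ),
      (∀ ξ, pFT G ξ = (besselSymbol r ξ : ℂ) * pFT (fun x ↦ φ x * planeWave v x) ξ) →
      eLpNorm (fun x ↦ G x - (besselSymbol r v : ℂ) * φ x * planeWave v x) p volume ≤
        ENNReal.ofReal (C * besselSymbol (r - 1 / 2) v) := by
  obtain ⟨t, C, hC⟩ := exists_norm_toLp_le_seminorm_schwartzPFT (d := d) p
  choose B N hB0 hB using fun n ↦ exists_norm_iteratedFDeriv_besselSymbol_sub_le (E := Ed d) n r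
  choose K hK0 hK using fun i : ℕ × ℕ ↦
    (schwartzPFT φ).exists_seminorm_smul_le i.1 i.2 B N hB0
  refine ⟨C * ∑ i ∈ t, K i, mul_nonneg C.2 (sum_nonneg fun i _ ↦ hK0 i), fun v G hG ↦ ?_⟩
  have hv := (besselSymbol_pos (r - 1 / 2) v).le
  let h : SchwartzMap (Ed d) ℂ :=
    SchwartzMap.smulLeftCLM ℂ (planeWave (-v)) G - (besselSymbol r v : ℂ) • φ
  have hshift : pFT (fun x ↦ planeWave (-v) x * (φ x * planeWave v x)) = pFT φ := by
    congr 1 with x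
    rw [mul_left_comm, planeWave_neg_mul_self, mul_one]
  have hFT (ξ : Ed d) : schwartzPFT h ξ =
      (besselSymbol r (ξ + v) - besselSymbol r v) • schwartzPFT φ ξ := by
    have hcoe : (SchwartzMap.smulLeftCLM ℂ (planeWave (-v)) G : Ed d → ℂ) =
        fun x ↦ planeWave (-v) x * G x :=
      funext fun x ↦ SchwartzMap.smulLeftCLM_apply_apply (hasTemperateGrowth_planeWave (-v)) G x
    rw [schwartzPFT_apply, schwartzPFT_apply, pFT_sub_const_mul, hcoe, pFT_planeWave_neg_mul, hG,
      ← pFT_planeWave_neg_mul, hshift, Complex.real_smul]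
    push_cast
    ring
  have hsemi : ∀ i ∈ t, schwartzSeminormFamily ℝ (Ed d) ℂ i (schwartzPFT h) ≤
      (∑ i ∈ t, K i) * besselSymbol (r - 1 / 2) v := fun i hi ↦ by
    refine (hK i _ _ _ hv ?_ (fun n _ x ↦ hB n v x) hFT).trans ?_
    · exact ((contDiff_besselSymbol r (n := i.2)).comp (contDiff_id.add contDiff_const)).sub
        contDiff_const
    · exact mul_le_mul_of_nonneg_right (single_le_sum (fun i _ ↦ hK0 i) hi) hv
  have hnorm : eLpNorm (fun x ↦ G x - (besselSymbol r v : ℂ) * φ x * planeWave v x) p volume =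
      eLpNorm h p volume := by
    refine eLpNorm_congr_norm_ae (Filter.Eventually.of_forall fun x ↦ ?_)
    have hx : h x = planeWave (-v) x * (G x - (besselSymbol r v : ℂ) * φ x * planeWave v x) := by
      have hGx := SchwartzMap.smulLeftCLM_apply_apply (hasTemperateGrowth_planeWave (-v)) G x
      change SchwartzMap.smulLeftCLM ℂ (planeWave (-v)) G x - (besselSymbol r v : ℂ) * φ x = _
      rw [hGx, smul_eq_mul]
      linear_combination (besselSymbol r v : ℂ) * φ x * planeWave_neg_mul_self v x
    rw [hx, norm_mul, norm_planeWave, one_mul]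
  rw [hnorm, ← ENNReal.ofReal_toReal (h.memLp p volume).eLpNorm_ne_top, ← SchwartzMap.norm_toLp]
  refine ENNReal.ofReal_le_ofReal ((hC h).trans ?_)
  rw [mul_assoc]
  refine mul_le_mul_of_nonneg_left ?_ C.2
  exact Seminorm.finset_sup_apply_le (mul_nonneg (sum_nonneg fun i _ ↦ hK0 i) hv) hsemi

end Fourier

theorem one_add_sq_rpow_le (t : ℝ) {k : ℝ} (hk : 1 ≤ k) :
    (1 + k ^ 2) ^ (t / 2) ≤ 2 ^ (|t| / 2) * k ^ t := by
  have hk0 : 0 ≤ k := by linarith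
  have hkt : k ^ t = (k ^ 2) ^ (t / 2) := by
    rw [← Real.rpow_natCast k 2, ← Real.rpow_mul hk0]
    congr 1
    push_cast
    ring
  rw [hkt]
  rcases le_total 0 t with ht | ht
  · rw [abs_of_nonneg ht, ← Real.mul_rpow (by norm_num) (by positivity)]
    exact Real.rpow_le_rpow (by positivity) (by nlinarith) (by linarith)
  · refine (Real.rpow_le_rpow_of_nonpos (y := 1 + k ^ 2) (x := k ^ 2) (by positivity)
      (by linarith) (by linarith)).trans ?_
    exact le_mul_of_one_le_left (by positivity)
      (Real.one_le_rpow (by norm_num) (by positivity))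

/-- `‖J^s(φ e^{ikx₁}) - ⟨k⟩^s φ e^{ikx₁}‖_p ≤ C(φ,d,s,p) k^{s-1}` for
all `k ≥ 1`, where `J^s(φ e^{ikx₁})` is the function `G` characterized by
`𝓕G(ξ) = (1+|ξ|²)^{s/2} 𝓕(φ e^{ikx₁})(ξ)` and `⟨k⟩ = (1+k²)^{1/2}`. -/
theorem stmt13 {d : ℕ} (hd : 0 < d) (s p : ℝ) (hs : 0 < s) (hp1 : 1 < p)
    (φ : SchwartzMap (Ed d) ℂ) :
    ∃ C : ℝ, 0 ≤ C ∧ ∀ k : ℝ, 1 ≤ k → ∀ G : SchwartzMap (Ed d) ℂ,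
      (∀ ξ : Ed d, pFT (⇑G) ξ =
        (((1 + ‖ξ‖ ^ 2) ^ (s / 2) : ℝ) : ℂ) *
          pFT (fun x => φ x * Complex.exp (Complex.I * ((k * x ⟨0, hd⟩ : ℝ) : ℂ))) ξ) →
      eLpNorm (fun x : Ed d =>
          G x - (((1 + k ^ 2) ^ (s / 2) : ℝ) : ℂ) * φ x *
            Complex.exp (Complex.I * ((k * x ⟨0, hd⟩ : ℝ) : ℂ)))
        (ENNReal.ofReal p) volume ≤ ENNReal.ofReal (C * k ^ (s - 1)) := by
  have hp : Fact (1 ≤ ENNReal.ofReal p) := ⟨ENNReal.one_le_ofReal.2 hp1.le⟩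
  obtain ⟨C, hC0, hC⟩ := exists_eLpNorm_bessel_planeWave_sub_le (s / 2) (ENNReal.ofReal p) φ
  refine ⟨C * 2 ^ (|s - 1| / 2), by positivity, fun k hk G hG ↦ ?_⟩
  let v : Ed d := EuclideanSpace.single ⟨0, hd⟩ k
  have hwave (x : Ed d) :
      planeWave v x = Complex.exp (Complex.I * ((k * x ⟨0, hd⟩ : ℝ) : ℂ)) := by
    simp [planeWave, v, EuclideanSpace.inner_single_right]
  have hbessel (r : ℝ) : besselSymbol r v = (1 + k ^ 2) ^ r := by
    simp [besselSymbol, v]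
  have h := hC v G (by simp only [hwave]; exact hG)
  simp only [hwave, hbessel] at h
  refine h.trans (ENNReal.ofReal_le_ofReal ?_)
  rw [mul_assoc, show s / 2 - 1 / 2 = (s - 1) / 2 by ring]
  exact mul_le_mul_of_nonneg_left (one_add_sq_rpow_le _ hk) hC0
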